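/- arXiv:1605.07937 — 8 statements merged into one kernel-verified Lean document; each statement's English description precedes it below -/
import Mathlib

section
/- Let I be a two-sided ideal of A. Then dim_F (Ann_A(I) ∩ Z(A)) = dim_F {x ∈ A | exe = x, x·(eye) = 0 for all y ∈ I, and x·(eae) = (eae)·x for all a ∈ A}; that is, the annihilator of I in A intersected with the center of A has the same F-dimension as the annihilator of eIe in the corner algebra eAe intersected with the center of eAe. -/
open Module

variable {F : Type*} [Field F]
variable {A : Type*} [Ring A] [Algebra F A]

/-- The orthogonal complement of a subspace `U` of `A` with respect to the bilinear form `B`: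
`U^⊥ = {a ∈ A | ⟨u, a⟩ = 0 for all u ∈ U}`. -/
def perpB (B : A →ₗ[F] A →ₗ[F] F) (U : Submodule F A) : Submodule F A where
  carrier := {a | ∀ u ∈ U, B u a = 0}
  add_mem' := by
    intro a b ha hb u hu
    simp [map_add, ha u hu, hb u hu]
  zero_mem' := by
    intro u hu
    simp
  smul_mem' := by
    intro c a ha u hu
    simp [ha u hu]

/-- The left annihilator `Ann_A(S) = {a ∈ A | u * a = 0 for all u ∈ S}` as an `F`-subspace. -/
def annL (F : Type*) [Field F] {A : Type*} [Ring A] [Algebra F A] (S : Set A) :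
    Submodule F A where
  carrier := {a | ∀ u ∈ S, u * a = 0}
  add_mem' := by
    intro a b ha hb u hu
    rw [mul_add, ha u hu, hb u hu, add_zero]
  zero_mem' := by
    intro u hu
    rw [mul_zero]
  smul_mem' := by
    intro c a ha u hu
    rw [mul_smul_comm, ha u hu, smul_zero]

/-- The commutator subspace `[U, V]`: the `F`-linear span of `{uv - vu | u ∈ U, v ∈ V}`. -/
def commSub (F : Type*) [Field F] {A : Type*} [Ring A] [Algebra F A]
    (U V : Submodule F A) : Submodule F A :=
  Submodule.span F {x | ∃ u ∈ U, ∃ v ∈ V, x = u * v - v * u}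

/-- The `F`-linear map `a ↦ e * a * f`. -/
def cornerMap (F : Type*) [Field F] {A : Type*} [Ring A] [Algebra F A] (e f : A) :
    A →ₗ[F] A :=
  (LinearMap.mulRight F f).comp (LinearMap.mulLeft F e)

/-- The subspace `e A f = {e * a * f | a ∈ A}`. -/
def cornerSub (F : Type*) [Field F] {A : Type*} [Ring A] [Algebra F A] (e f : A) :
    Submodule F A :=
  LinearMap.range (cornerMap F e f)

/-- The subspace `e S f = {e * x * f | x ∈ S}` for an ideal `S` of `A`. -/
def cornerOf (F : Type*) [Field F] {A : Type*} [Ring A] [Algebra F A] (e f : A)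
    (S : Ideal A) : Submodule F A :=
  Submodule.map (cornerMap F e f) (S.restrictScalars F)

/-- The center `Z(A)` of `A` as an `F`-subspace. -/
def centerSub (F : Type*) [Field F] (A : Type*) [Ring A] [Algebra F A] : Submodule F A :=
  Subalgebra.toSubmodule (Subalgebra.center F A)

/-- The Jacobson radical `J` of the ring `A`. -/
noncomputable def jac (A : Type*) [Ring A] : Ideal A := Ideal.jacobson (⊥ : Ideal A)

/-- The right annihilator `{a ∈ A | a * u = 0 for all u ∈ S}` as an `F`-subspace. -/
def annR (F : Type*) [Field F] {A : Type*} [Ring A] [Algebra F A] (S : Set A) :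
    Submodule F A where
  carrier := {a | ∀ u ∈ S, a * u = 0}
  add_mem' := by
    intro a b ha hb u hu
    rw [add_mul, ha u hu, hb u hu, add_zero]
  zero_mem' := by
    intro u hu
    rw [zero_mul]
  smul_mem' := by
    intro c a ha u hu
    rw [smul_mul_assoc, ha u hu, smul_zero]

/-- The subspace of elements of `A` commuting with every element of `S`. -/
def commWith (F : Type*) [Field F] {A : Type*} [Ring A] [Algebra F A] (S : Set A) :
    Submodule F A where
  carrier := {a | ∀ s ∈ S, a * s = s * a}
  add_mem' := by
    intro a b ha hb s hs
    rw [add_mul, mul_add, ha s hs, hb s hs]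
  zero_mem' := by
    intro s hs
    rw [zero_mul, mul_zero]
  smul_mem' := by
    intro c a ha s hs
    rw [smul_mul_assoc, ha s hs, mul_smul_comm]

theorem full_induction_aux {e : A}
    (hfull : Submodule.span F {x : A | ∃ a b : A, x = a * e * b} = ⊤)
    (f : A →ₗ[F] A) (h : ∀ a b : A, f (a * e * b) = 0) (w : A) : f w = 0 := by
  have hw : w ∈ Submodule.span F {x : A | ∃ a b : A, x = a * e * b} := by
    rw [hfull]; trivial
  have hle : Submodule.span F {x : A | ∃ a b : A, x = a * e * b} ≤ LinearMap.ker f := by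
    rw [Submodule.span_le]
    rintro _ ⟨a, b, rfl⟩
    exact h a b
  exact hle hw

theorem lift_exists_aux {e : A}
    (hfull : Submodule.span F {x : A | ∃ a b : A, x = a * e * b} = ⊤)
    (x : A) (hex : e * x = x) (hxe : x * e = x)
    (hc : ∀ a : A, x * (e * a * e) = e * a * e * x) :
    ∃ z : A, ∀ c : A, z * c * e = c * x := by
  have key : ∀ w ∈ Submodule.span F {x : A | ∃ a b : A, x = a * e * b},
      ∃ z : A, ∀ c : A, z * c * e = w * c * x := by
    intro w hw
    induction hw using Submodule.span_induction with
    | mem w hw =>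
      obtain ⟨a, b, rfl⟩ := hw
      refine ⟨a * x * b, fun c => ?_⟩
      have h := hc (b * c)
      calc a * x * b * c * e = a * ((x * e) * b * c * e) := by rw [hxe]; noncomm_ring
        _ = a * (x * (e * (b * c) * e)) := by noncomm_ring
        _ = a * (e * (b * c) * (e * x)) := by rw [h]; noncomm_ring
        _ = a * e * b * c * x := by rw [hex]; noncomm_ring
    | zero => exact ⟨0, fun c => by simp⟩
    | add w₁ w₂ _ _ h₁ h₂ =>
      obtain ⟨z₁, h₁⟩ := h₁
      obtain ⟨z₂, h₂⟩ := h₂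
      exact ⟨z₁ + z₂, fun c => by simp only [add_mul, h₁, h₂]⟩
    | smul r w _ h =>
      obtain ⟨z, h⟩ := h
      exact ⟨r • z, fun c => by simp only [smul_mul_assoc, h]⟩
  obtain ⟨z, hz⟩ := key 1 (by rw [hfull]; trivial)
  exact ⟨z, fun c => by rw [hz, one_mul]⟩

theorem finrank_ann_inter_center_corner [FiniteDimensional F A]
    (e : A) (he : e * e = e)
    (hfull : Submodule.span F {x : A | ∃ a b : A, x = a * e * b} = ⊤)
    (I : Submodule F A)
    (hIleft : ∀ a : A, ∀ u ∈ I, a * u ∈ I)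
    (hIright : ∀ a : A, ∀ u ∈ I, u * a ∈ I) :
    finrank F ↥(annL F (I : Set A) ⊓ centerSub F A) =
      finrank F
        ↥(LinearMap.eqLocus (cornerMap F e e) (LinearMap.id : A →ₗ[F] A) ⊓
          annR F {x : A | ∃ y ∈ I, x = e * y * e} ⊓
          commWith F {x : A | ∃ a : A, x = e * a * e}) := by
  have mem1 : ∀ z : A, z ∈ annL F (I : Set A) ⊓ centerSub F A ↔
      (∀ u ∈ I, u * z = 0) ∧ ∀ a, a * z = z * a := by
    intro z
    refine and_congr Iff.rfl ?_
    change z ∈ Subalgebra.center F A ↔ _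
    rw [Subalgebra.mem_center_iff]
  have mem2 : ∀ x : A, x ∈ (LinearMap.eqLocus (cornerMap F e e) (LinearMap.id : A →ₗ[F] A) ⊓
          annR F {x : A | ∃ y ∈ I, x = e * y * e} ⊓
          commWith F {x : A | ∃ a : A, x = e * a * e}) ↔
      (e * x * e = x ∧ ∀ y ∈ I, x * (e * y * e) = 0) ∧
        ∀ a, x * (e * a * e) = e * a * e * x := by
    intro x
    refine and_congr (and_congr Iff.rfl ?_) ?_
    · constructor
      · intro h y hy
        exact h _ ⟨y, hy, rfl⟩
      · rintro h _ ⟨y, hy, rfl⟩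
        exact h y hy
    · constructor
      · intro h a
        exact h _ ⟨a, rfl⟩
      · rintro h _ ⟨a, rfl⟩
        exact h a
  have maps : ∀ z ∈ annL F (I : Set A) ⊓ centerSub F A, LinearMap.mulRight F e z ∈
      (LinearMap.eqLocus (cornerMap F e e) (LinearMap.id : A →ₗ[F] A) ⊓
          annR F {x : A | ∃ y ∈ I, x = e * y * e} ⊓
          commWith F {x : A | ∃ a : A, x = e * a * e}) := by
    intro z hz
    rw [mem1] at hz
    obtain ⟨h0, hz⟩ := hz
    rw [mem2, LinearMap.mulRight_apply]
    refine ⟨⟨?_, ?_⟩, ?_⟩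
    · rw [← mul_assoc, hz e, mul_assoc, mul_assoc, he, he]
    · intro y hy
      rw [mul_assoc, ← hz]
      have hm : e * (e * y * e) ∈ I := hIleft _ _ (hIright _ _ (hIleft _ _ hy))
      exact h0 _ hm
    · intro a
      rw [mul_assoc, ← mul_assoc (e * a * e) z e, hz (e * a * e), mul_assoc z]
      congr 1
      rw [mul_assoc (e * a) e e, he, ← mul_assoc, ← mul_assoc, he]
  refine LinearEquiv.finrank_eq (LinearEquiv.ofBijective
    ((LinearMap.mulRight F e).restrict maps) ⟨?_, ?_⟩)
  · rw [← LinearMap.ker_eq_bot, LinearMap.ker_eq_bot']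
    rintro ⟨z, hz⟩ h
    have h' : z * e = 0 := congrArg Subtype.val h
    rw [mem1] at hz
    apply Subtype.ext
    change z = 0
    have := full_induction_aux hfull (LinearMap.mulLeft F z) (fun a b => by
      rw [LinearMap.mulLeft_apply, ← mul_assoc, ← mul_assoc, ← hz.2 a, mul_assoc a, h']
      simp) 1
    simpa using this
  · rintro ⟨x, hx⟩
    have hx' := hx
    rw [mem2] at hx'
    obtain ⟨⟨hxx, h0⟩, hc⟩ := hx'
    have hex : e * x = x := by
      rw [← hxx, ← mul_assoc, ← mul_assoc, he]
    have hxe : x * e = x := by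
      rw [← hxx, mul_assoc, he]
    obtain ⟨z, hz⟩ := lift_exists_aux hfull x hex hxe hc
    have hvx : ∀ v ∈ I, v * x = 0 := by
      intro v hv
      have := full_induction_aux hfull (LinearMap.mulRight F (v * x)) (fun a b => by
        rw [LinearMap.mulRight_apply]
        calc a * e * b * (v * x) = a * e * b * (v * (e * x)) := by rw [hex]
          _ = a * (e * (b * v) * e * x) := by noncomm_ring
          _ = 0 := by rw [← hc, h0 _ (hIleft b v hv), mul_zero]) 1
      simpa using this
    have hz1 : z ∈ annL F (I : Set A) ⊓ centerSub F A := by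
      rw [mem1]
      constructor
      · intro u hu
        have := full_induction_aux hfull (LinearMap.mulLeft F (u * z)) (fun a b => by
          rw [LinearMap.mulLeft_apply]
          calc u * z * (a * e * b) = u * (z * a * e) * b := by noncomm_ring
            _ = (u * a) * x * b := by rw [hz]; noncomm_ring
            _ = 0 := by rw [hvx _ (hIright a u hu), zero_mul]) 1
        simpa using this
      · intro c
        have := full_induction_aux hfull (LinearMap.mulLeft F (c * z - z * c)) (fun a b => by
          rw [LinearMap.mulLeft_apply]
          calc (c * z - z * c) * (a * e * b)
              = (c * (z * a * e) - z * (c * a) * e) * b := by noncomm_ring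
            _ = 0 := by rw [hz, hz, mul_assoc c a x, sub_self, zero_mul]) 1
        exact sub_eq_zero.mp (by simpa using this)
    refine ⟨⟨z, hz1⟩, Subtype.ext ?_⟩
    change z * e = x
    simpa using hz 1
end

section
/- The commutator subspace of A satisfies [A,A] ⊆ Σ_{1 ≤ i, j ≤ l} [e_i A e_j, e_j A e_i] + Σ_{1 ≤ i ≠ j ≤ l} e_i A e_j. -/
open Module

variable {F : Type*} [Field F]
variable {A : Type*} [Ring A] [Algebra F A]

theorem commutator_le_sum
    (l : ℕ) (e : Fin l → A)
    (hidem : ∀ i, e i * e i = e i)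
    (horth : ∀ i j, i ≠ j → e i * e j = 0)
    (hone : ∑ i, e i = 1) :
    commSub F (⊤ : Submodule F A) ⊤ ≤
      (⨆ i, ⨆ j, commSub F (cornerSub F (e i) (e j)) (cornerSub F (e j) (e i))) ⊔
        (⨆ i, ⨆ j, ⨆ _ : i ≠ j, cornerSub F (e i) (e j)) := by
  set S := (⨆ i, ⨆ j, commSub F (cornerSub F (e i) (e j)) (cornerSub F (e j) (e i))) ⊔
        (⨆ i, ⨆ j, ⨆ _ : i ≠ j, cornerSub F (e i) (e j)) with hS
  have hmem : ∀ (x y a : A), x * a * y ∈ cornerSub F x y := fun x y a => ⟨a, rfl⟩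
  have hC : ∀ i j (u v : A), u ∈ cornerSub F (e i) (e j) → v ∈ cornerSub F (e j) (e i) →
      u * v - v * u ∈ S := by
    intro i j u v hu hv
    refine Submodule.mem_sup_left (Submodule.mem_iSup_of_mem i (Submodule.mem_iSup_of_mem j ?_))
    exact Submodule.subset_span ⟨u, hu, v, hv, rfl⟩
  have hO : ∀ i j (u : A), i ≠ j → u ∈ cornerSub F (e i) (e j) → u ∈ S := by
    intro i j u hij hu
    exact Submodule.mem_sup_right (Submodule.mem_iSup_of_mem i (Submodule.mem_iSup_of_mem j
      (Submodule.mem_iSup_of_mem hij hu)))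
  have hP : ∀ i j k m (a b : A), i ≠ m → (e i * a * e j) * (e k * b * e m) ∈ S := by
    intro i j k m a b him
    apply hO i m _ him
    have h : (e i * a * e j) * (e k * b * e m) = e i * (a * e j * e k * b) * e m := by
      simp only [mul_assoc]
    rw [h]
    exact hmem _ _ _
  have hZ : ∀ i j k m (a b : A), j ≠ k → (e i * a * e j) * (e k * b * e m) = 0 := by
    intro i j k m a b hjk
    have h : (e i * a * e j) * (e k * b * e m) = e i * a * (e j * e k) * b * e m := by
      simp only [mul_assoc]
    rw [h, horth j k hjk]
    simp
  have hK : ∀ i j k m (a b : A), (e i * a * e j) * (e k * b * e m)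
      - (e k * b * e m) * (e i * a * e j) ∈ S := by
    intro i j k m a b
    by_cases hjk : j = k
    · by_cases him : i = m
      · subst hjk him
        exact hC i j _ _ (hmem _ _ _) (hmem _ _ _)
      · rw [hZ k m i j b a (Ne.symm him), sub_zero]
        exact hP i j k m a b him
    · rw [hZ i j k m a b hjk, zero_sub]
      exact S.neg_mem (hP k m i j b a (Ne.symm hjk))
  refine Submodule.span_le.2 ?_
  rintro x ⟨a, -, b, -, rfl⟩
  -- first expand `a`, then `b`
  have h1 : ∀ i j, (e i * a * e j) * b - b * (e i * a * e j) ∈ S := by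
    intro i j
    have h : (e i * a * e j) * b - b * (e i * a * e j) = ∑ k, ∑ m,
        ((e i * a * e j) * (e k * b * e m) - (e k * b * e m) * (e i * a * e j)) := by
      simp only [Finset.sum_sub_distrib]
      simp only [← Finset.mul_sum, ← Finset.sum_mul]
      simp only [hone, one_mul, mul_one]
    rw [h]
    exact S.sum_mem fun k _ => S.sum_mem fun m _ => hK i j k m a b
  have h : a * b - b * a = ∑ i, ∑ j, ((e i * a * e j) * b - b * (e i * a * e j)) := by
    simp only [Finset.sum_sub_distrib]
    simp only [← Finset.mul_sum, ← Finset.sum_mul]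
    simp only [hone, one_mul, mul_one]
  rw [h]
  exact S.sum_mem fun i _ => S.sum_mem fun j _ => h1 i j
end

section
/- For every integer n ≥ 1, dim_F (Ann_A(J^n) ∩ Z(A)) ≤ Σ_{1 ≤ i ≤ l} (dim_F e_i A e_i − dim_F e_i J^n e_i). -/
open Module

variable {F : Type*} [Field F]
variable {A : Type*} [Ring A] [Algebra F A]

theorem finrank_ann_inter_center_le [FiniteDimensional F A]
    (B : A →ₗ[F] A →ₗ[F] F)
    (hsymm : ∀ a b : A, B a b = B b a)
    (hnondeg : ∀ a : A, (∀ b : A, B a b = 0) → a = 0)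
    (hassoc : ∀ a b c : A, B (a * b) c = B a (b * c))
    (l : ℕ) (e : Fin l → A)
    (hidem : ∀ i, e i * e i = e i)
    (horth : ∀ i j, i ≠ j → e i * e j = 0)
    (hone : ∑ i, e i = 1)
    (n : ℕ) (hn : 1 ≤ n) :
    finrank F ↥(annL F ((jac A ^ n : Ideal A) : Set A) ⊓ centerSub F A) ≤
      ∑ i, (finrank F (cornerSub F (e i) (e i)) -
        finrank F (cornerOf F (e i) (e i) (jac A ^ n))) := by
  classical
  have hle : ∀ i, cornerOf F (e i) (e i) (jac A ^ n) ≤ cornerSub F (e i) (e i) := by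
    intro i
    exact LinearMap.map_le_range
  let T : ∀ i, Submodule F (cornerSub F (e i) (e i)) := fun i =>
    (cornerOf F (e i) (e i) (jac A ^ n)).submoduleOf (cornerSub F (e i) (e i))
  have hT : ∀ i, finrank F (T i).dualAnnihilator = finrank F (cornerSub F (e i) (e i)) -
        finrank F (cornerOf F (e i) (e i) (jac A ^ n)) := by
    intro i
    have h1 := Subspace.finrank_add_finrank_dualAnnihilator_eq (T i)
    have h2 : finrank F (T i) = finrank F (cornerOf F (e i) (e i) (jac A ^ n)) :=
      (Submodule.submoduleOfEquivOfLe (hle i)).finrank_eq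
    omega
  have hfree : ∀ i, Module.Free F (T i).dualAnnihilator := fun i =>
    Module.Free.of_equiv (T i).dualQuotEquivDualAnnihilator
  have hfinite : ∀ i, Module.Finite F (T i).dualAnnihilator := fun i => inferInstance
  rw [← Finset.sum_congr rfl (fun i _ => hT i), ← Module.finrank_pi_fintype]
  have hmem : ∀ (i : Fin l) (z : ↥(annL F ((jac A ^ n : Ideal A) : Set A) ⊓ centerSub F A)),
      (B z.1).comp (cornerSub F (e i) (e i)).subtype ∈ (T i).dualAnnihilator := by
    rintro i ⟨z, hz, hc⟩
    rw [Submodule.mem_dualAnnihilator]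
    rintro ⟨w, hw⟩ ⟨y, hy, hyw⟩
    have hyw' : e i * y * e i = w := hyw
    have hcz : e i * z = z * e i := (Subalgebra.mem_center_iff (R := F)).mp hc (e i)
    have hyz : y * z = 0 := hz y hy
    change B z w = 0
    rw [← hyw', hsymm, hassoc, hcz, hassoc, ← mul_assoc, hyz]
    simp
  let Φ : ↥(annL F ((jac A ^ n : Ideal A) : Set A) ⊓ centerSub F A) →ₗ[F]
      (∀ i, (T i).dualAnnihilator) :=
    LinearMap.pi fun i => LinearMap.codRestrict _
      { toFun := fun z => (B z.1).comp (cornerSub F (e i) (e i)).subtype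
        map_add' := by intro a b; ext; simp
        map_smul' := by intro a b; ext; simp } (hmem i)
  apply LinearMap.finrank_le_finrank_of_injective (f := Φ)
  rw [injective_iff_map_eq_zero]
  rintro ⟨z, hz, hc⟩ h0
  have key : ∀ i a, B z (e i * a * e i) = 0 := by
    intro i a
    have h1 := congrArg Subtype.val (congrFun h0 i)
    exact LinearMap.congr_fun h1 ⟨e i * a * e i, ⟨a, rfl⟩⟩
  apply Subtype.ext
  apply hnondeg
  intro a
  change B z a = 0
  have ha : a = ∑ i, a * e i := by rw [← Finset.mul_sum, hone, mul_one]
  rw [ha, map_sum]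
  apply Finset.sum_eq_zero
  intro i _
  have hcz : e i * z = z * e i := (Subalgebra.mem_center_iff (R := F)).mp hc (e i)
  have h2 : B z (a * e i) = B z (e i * a * e i) := by
    calc B z (a * e i) = B (a * e i * e i) z := by rw [mul_assoc, hidem, hsymm]
      _ = B z (e i * a * e i) := by
        rw [hassoc, hcz, hsymm, hassoc, mul_assoc]
  rw [h2, key]
end

section
/- dim_F Z(A) ≤ Σ_{1 ≤ i ≤ l} dim_F e_i A e_i. (This is the analogue, for the symmetric algebra A, of the classical inequality k(B) ≤ tr C_B for a block B with Cartan matrix C_B.) -/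
open Module

variable {F : Type*} [Field F]
variable {A : Type*} [Ring A] [Algebra F A]

theorem finrank_center_le [FiniteDimensional F A]
    (B : A →ₗ[F] A →ₗ[F] F)
    (hsymm : ∀ a b : A, B a b = B b a)
    (hnondeg : ∀ a : A, (∀ b : A, B a b = 0) → a = 0)
    (hassoc : ∀ a b c : A, B (a * b) c = B a (b * c))
    (l : ℕ) (e : Fin l → A)
    (hidem : ∀ i, e i * e i = e i)
    (horth : ∀ i j, i ≠ j → e i * e j = 0)
    (hone : ∑ i, e i = 1) :
    finrank F (centerSub F A) ≤ ∑ i, finrank F (cornerSub F (e i) (e i)) := by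
  let f : centerSub F A →ₗ[F] (∀ i, cornerSub F (e i) (e i)) :=
    LinearMap.pi fun i => (cornerMap F (e i) (e i)).rangeRestrict.comp (centerSub F A).subtype
  have hf : Function.Injective f := by
    rw [← LinearMap.ker_eq_bot, LinearMap.ker_eq_bot']
    rintro ⟨z, hz⟩ h
    have hz' : ∀ b : A, b * z = z * b := by
      have h1 : z ∈ Subalgebra.center F A := hz
      exact Subalgebra.mem_center_iff.mp h1
    have h0 : ∀ i, z * e i = 0 := by
      intro i
      have h2 : e i * z * e i = 0 := congrArg Subtype.val (congrFun h i)
      rwa [hz', mul_assoc, hidem] at h2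
    have h3 : z = 0 := by
      rw [← mul_one z, ← hone, Finset.mul_sum]
      exact Finset.sum_eq_zero fun i _ => h0 i
    exact Subtype.ext h3
  have := LinearMap.finrank_le_finrank_of_injective hf
  rwa [Module.finrank_pi_fintype] at this
end

section
/- Let n ≥ 1 be an integer. The following are equivalent: (1) dim_F (Ann_A(J^n) ∩ Z(A)) = Σ_{1 ≤ i ≤ l} (dim_F e_i A e_i − dim_F e_i J^n e_i); (2) [e_i A e_j, e_j A e_i] ⊆ e_i J^n e_i + e_j J^n e_j for all 1 ≤ i, j ≤ l. -/
open Module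

variable {F : Type*} [Field F]
variable {A : Type*} [Ring A] [Algebra F A]

theorem aux_corner_mem {e f x : A} (I : Ideal A) [I.IsTwoSided]
    (hx : e * x * f = x) : x ∈ cornerOf F e f I ↔ x ∈ I := by
  constructor
  · rintro ⟨y, hy, rfl⟩
    have hy' : y ∈ I := hy
    exact I.mul_mem_right _ (I.mul_mem_left _ hy')
  · intro h
    exact ⟨x, h, hx⟩

/-- Elements whose diagonal corners all lie in `I`. -/
def auxW (F : Type*) [Field F] {A : Type*} [Ring A] [Algebra F A] {l : ℕ} (e : Fin l → A)
    (I : Ideal A) : Submodule F A :=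
  ⨅ i, (I.restrictScalars F).comap (cornerMap F (e i) (e i))

theorem mem_auxW {l : ℕ} (e : Fin l → A) (I : Ideal A) (a : A) :
    a ∈ auxW F e I ↔ ∀ i, e i * a * e i ∈ I := by
  simp [auxW, cornerMap]

theorem aux_pi {F : Type*} [Field F] {A : Type*} [AddCommGroup A] [Module F A]
    [FiniteDimensional F A] {l : ℕ} (Q : Fin l → Type*)
    [∀ i, AddCommGroup (Q i)] [∀ i, Module F (Q i)] [∀ i, FiniteDimensional F (Q i)]
    (φ : A →ₗ[F] (∀ i, Q i)) (hsurj : Function.Surjective φ) :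
    (∑ i, finrank F (Q i)) + finrank F (LinearMap.ker φ) = finrank F A := by
  have h1 := LinearMap.finrank_range_add_finrank_ker φ
  rwa [LinearMap.range_eq_top.2 hsurj, finrank_top, Module.finrank_pi_fintype] at h1

theorem aux_gen [FiniteDimensional F A] {l : ℕ} (C D : Fin l → Submodule F A)
    (hle : ∀ i, D i ≤ C i) (p : Fin l → A →ₗ[F] A) (hp : ∀ i a, p i a ∈ C i)
    (hs : ∀ c : Fin l → A, (∀ i, c i ∈ C i) → ∃ a, ∀ i, p i a = c i) :
    (∑ i, (finrank F (C i) - finrank F (D i)))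
      + finrank F (⨅ i, (D i).comap (p i) : Submodule F A) = finrank F A := by
  let φ : A →ₗ[F] (∀ i, C i ⧸ (D i).submoduleOf (C i)) :=
    LinearMap.pi fun i => ((D i).submoduleOf (C i)).mkQ.comp ((p i).codRestrict (C i) (hp i))
  have hφ : ∀ a i, φ a i = Submodule.Quotient.mk ⟨p i a, hp i a⟩ := fun a i => rfl
  have hker : LinearMap.ker φ = ⨅ i, (D i).comap (p i) := by
    ext a
    rw [LinearMap.mem_ker, funext_iff, Submodule.mem_iInf]
    refine forall_congr' fun i => ?_
    rw [hφ, Pi.zero_apply, Submodule.Quotient.mk_eq_zero]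
    rfl
  have hsurj : Function.Surjective φ := by
    intro q
    choose c hc using fun i => Submodule.Quotient.mk_surjective _ (q i)
    obtain ⟨a, ha⟩ := hs (fun i => c i) (fun i => (c i).2)
    refine ⟨a, funext fun i => ?_⟩
    rw [hφ, ← hc i]
    congr 1
    exact Subtype.ext (ha i)
  have h1 := aux_pi (fun i => C i ⧸ (D i).submoduleOf (C i)) φ hsurj
  rw [hker] at h1
  rw [← h1]
  congr 1
  refine Finset.sum_congr rfl fun i _ => ?_
  have h2 := Submodule.finrank_quotient_add_finrank ((D i).submoduleOf (C i))
  rw [(Submodule.submoduleOfEquivOfLe (hle i)).finrank_eq] at h2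
  omega

theorem aux_finrank [FiniteDimensional F A] {l : ℕ} (e : Fin l → A)
    (hidem : ∀ i, e i * e i = e i)
    (horth : ∀ i j, i ≠ j → e i * e j = 0) (I : Ideal A) [I.IsTwoSided] :
    (∑ i, (finrank F (cornerSub F (e i) (e i)) - finrank F (cornerOf F (e i) (e i) I)))
      + finrank F (auxW F e I) = finrank F A := by
  have hW : auxW F e I = ⨅ i, (cornerOf F (e i) (e i) I).comap (cornerMap F (e i) (e i)) := by
    ext a
    rw [mem_auxW, Submodule.mem_iInf]
    refine forall_congr' fun i => ?_
    rw [← aux_corner_mem (F := F) I (e := e i) (f := e i)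
      (by simp only [mul_assoc, hidem]; simp only [← mul_assoc, hidem])]
    rfl
  rw [hW]
  refine aux_gen _ _ ?_ _ ?_ ?_
  · rintro i _ ⟨y, _, rfl⟩
    exact ⟨y, rfl⟩
  · intro i a
    exact ⟨a, rfl⟩
  · intro c hc
    choose a ha using hc
    refine ⟨∑ j, e j * a j * e j, fun i => ?_⟩
    rw [← ha i]
    change e i * (∑ j, e j * a j * e j) * e i = e i * a i * e i
    rw [Finset.mul_sum, Finset.sum_mul, Finset.sum_eq_single i]
    · simp only [mul_assoc, hidem]; simp only [← mul_assoc, hidem]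
    · intro j _ hj
      simp only [← mul_assoc, horth i j hj.symm, zero_mul]
    · simp

theorem aux_comm_iff {l : ℕ} (e : Fin l → A)
    (hidem : ∀ i, e i * e i = e i)
    (horth : ∀ i j, i ≠ j → e i * e j = 0)
    (hone : ∑ i, e i = 1) (I : Ideal A) [I.IsTwoSided] :
    commSub F (⊤ : Submodule F A) ⊤ ≤ auxW F e I ↔
    ∀ i j, commSub F (cornerSub F (e i) (e j)) (cornerSub F (e j) (e i)) ≤
        cornerOf F (e i) (e i) I ⊔ cornerOf F (e j) (e j) I := by
  have hi : ∀ i x, e i * (e i * x) = e i * x := fun i x => by rw [← mul_assoc, hidem]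
  have ho : ∀ i j, i ≠ j → ∀ x, e i * (e j * x) = 0 := fun i j h x => by
    rw [← mul_assoc, horth i j h, zero_mul]
  constructor
  · intro h i j
    refine Submodule.span_le.2 ?_
    rintro _ ⟨_, ⟨a, rfl⟩, _, ⟨b, rfl⟩, rfl⟩
    change e i * a * e j * (e j * b * e i) - e j * b * e i * (e i * a * e j) ∈ _
    set u := e i * a * e j with hu
    set v := e j * b * e i with hv
    have hW := (mem_auxW e I _).1 (h (Submodule.subset_span ⟨u, trivial, v, trivial, rfl⟩))
    by_cases hij : i = j
    · subst hij
      refine Submodule.mem_sup_left ((aux_corner_mem I ?_).2 ?_)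
      · simp only [hu, hv, mul_sub, sub_mul, mul_assoc, hi, hidem]
      · have := hW i
        simpa only [hu, hv, mul_sub, sub_mul, mul_assoc, hi, hidem] using this
    · rw [sub_eq_add_neg]
      refine Submodule.add_mem_sup ((aux_corner_mem I ?_).2 ?_)
        (neg_mem ((aux_corner_mem I ?_).2 ?_))
      · simp only [hu, hv, mul_assoc, hi, hidem]
      · have := hW i
        simpa only [hu, hv, mul_sub, sub_mul, mul_assoc, hi, hidem, ho i j hij, sub_zero] using this
      · simp only [hu, hv, mul_assoc, hi, hidem]
      · have := hW j
        simpa only [hu, hv, mul_sub, sub_mul, mul_assoc, hi, hidem, ho j i (Ne.symm hij), zero_sub,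
          neg_mul, neg_mem_iff] using this
  · intro h
    refine Submodule.span_le.2 ?_
    rintro _ ⟨a, -, b, -, rfl⟩
    refine (mem_auxW e I _).2 fun i => ?_
    have hI : ∀ j x, x ∈ cornerOf F (e j) (e j) I → x ∈ I := by
      rintro j _ ⟨y, hy, rfl⟩
      have hy' : y ∈ I := hy
      exact I.mul_mem_right _ (I.mul_mem_left _ hy')
    have hc : ∀ j a b, e i * a * e j * (e j * b * e i) - e j * b * e i * (e i * a * e j) ∈ I := by
      intro j a b
      have := h i j (Submodule.subset_span
        ⟨e i * a * e j, ⟨a, rfl⟩, e j * b * e i, ⟨b, rfl⟩, rfl⟩)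
      obtain ⟨y, hy, z, hz, hyz⟩ := Submodule.mem_sup.1 this
      rw [← hyz]
      exact add_mem (hI _ _ hy) (hI _ _ hz)
    have hd : ∀ j, j ≠ i → ∀ a b, e i * a * e j * (e j * b * e i) ∈ I := by
      intro j hj a b
      have := I.mul_mem_left (e i) (hc j a b)
      simpa only [mul_sub, mul_assoc, hi, ho i j hj.symm, sub_zero] using this
    have hs : ∀ a b, e i * (a * b) * e i = ∑ j, e i * a * e j * (e j * b * e i) := by
      intro a b
      calc e i * (a * b) * e i = e i * a * (∑ j, e j) * (b * e i) := by
            rw [hone]; simp only [mul_assoc, one_mul]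
        _ = _ := by
            rw [Finset.mul_sum, Finset.sum_mul]
            simp only [mul_assoc, hi]
    rw [mul_sub, sub_mul, hs, hs, ← Finset.sum_sub_distrib]
    refine sum_mem fun j _ => ?_
    by_cases hj : j = i
    · subst hj
      exact hc j a b
    · exact sub_mem (hd j hj a b) (hd j hj b a)

theorem aux_W_le {l : ℕ} (e : Fin l → A)
    (hidem : ∀ i, e i * e i = e i)
    (horth : ∀ i j, i ≠ j → e i * e j = 0)
    (hone : ∑ i, e i = 1) (I : Ideal A) :
    auxW F e I ≤ I.restrictScalars F ⊔ commSub F (⊤ : Submodule F A) ⊤ := by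
  intro a ha
  rw [mem_auxW] at ha
  have : a = ∑ i, ∑ j, e i * a * e j := by
    simp only [← Finset.mul_sum, ← Finset.sum_mul, hone, one_mul, mul_one]
  rw [this]
  refine sum_mem fun i _ => sum_mem fun j _ => ?_
  by_cases hij : i = j
  · subst hij
    exact Submodule.mem_sup_left (ha i)
  · refine Submodule.mem_sup_right (Submodule.subset_span
      ⟨e i, trivial, e i * a * e j, trivial, ?_⟩)
    simp only [mul_assoc, horth j i (Ne.symm hij), mul_zero, sub_zero]
    simp only [← mul_assoc, hidem]

theorem aux_perp [FiniteDimensional F A]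
    (B : A →ₗ[F] A →ₗ[F] F)
    (hsymm : ∀ a b : A, B a b = B b a)
    (hnondeg : ∀ a : A, (∀ b : A, B a b = 0) → a = 0)
    (hassoc : ∀ a b c : A, B (a * b) c = B a (b * c)) (I : Ideal A) :
    annL F (I : Set A) ⊓ centerSub F A =
      LinearMap.BilinForm.orthogonal B
        (I.restrictScalars F ⊔ commSub F (⊤ : Submodule F A) ⊤) := by
  have key : ∀ u v a, B (u * v - v * u) a = B (v * a - a * v) u := by
    intro u v a
    rw [map_sub, LinearMap.sub_apply, map_sub, LinearMap.sub_apply, hassoc u, hassoc v,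
      hassoc a, hsymm u, hsymm a, hassoc v u a]
  ext a
  rw [Submodule.mem_inf, LinearMap.BilinForm.mem_orthogonal_iff]
  constructor
  · rintro ⟨h1, h2⟩ x hx
    obtain ⟨y, hy, z, hz, rfl⟩ := Submodule.mem_sup.1 hx
    change B (y + z) a = 0
    have hy0 : B y a = 0 := by
      rw [← one_mul y, hassoc, h1 y hy, map_zero]
    have hz0 : B z a = 0 := by
      have : commSub F (⊤ : Submodule F A) ⊤ ≤ LinearMap.ker (B.flip a) := by
        refine Submodule.span_le.2 ?_
        rintro _ ⟨u, -, v, -, rfl⟩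
        change B (u * v - v * u) a = 0
        have h3 : v * a = a * v := (Subalgebra.mem_center_iff (R := F)).1 h2 v
        rw [key, h3, sub_self, map_zero, LinearMap.zero_apply]
      exact this hz
    rw [map_add, LinearMap.add_apply, hy0, hz0, add_zero]
  · intro h
    constructor
    · intro x hx
      refine hnondeg _ fun b => ?_
      rw [hsymm, ← hassoc]
      exact h _ (Submodule.mem_sup_left (I.mul_mem_left b hx))
    · refine (Subalgebra.mem_center_iff (R := F)).2 fun v => sub_eq_zero.1 (hnondeg _ fun u => ?_)
      rw [← key]
      exact h _ (Submodule.mem_sup_right (Submodule.subset_span ⟨u, trivial, v, trivial, rfl⟩))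

theorem ann_center_eq_iff [FiniteDimensional F A]
    (B : A →ₗ[F] A →ₗ[F] F)
    (hsymm : ∀ a b : A, B a b = B b a)
    (hnondeg : ∀ a : A, (∀ b : A, B a b = 0) → a = 0)
    (hassoc : ∀ a b c : A, B (a * b) c = B a (b * c))
    (l : ℕ) (e : Fin l → A)
    (hidem : ∀ i, e i * e i = e i)
    (horth : ∀ i j, i ≠ j → e i * e j = 0)
    (hone : ∑ i, e i = 1)
    (n : ℕ) (hn : 1 ≤ n) :
    finrank F ↥(annL F ((jac A ^ n : Ideal A) : Set A) ⊓ centerSub F A) =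
        (∑ i, (finrank F (cornerSub F (e i) (e i)) -
          finrank F (cornerOf F (e i) (e i) (jac A ^ n)))) ↔
      ∀ i j, commSub F (cornerSub F (e i) (e j)) (cornerSub F (e j) (e i)) ≤
        cornerOf F (e i) (e i) (jac A ^ n) ⊔ cornerOf F (e j) (e j) (jac A ^ n) := by
  have : (jac A).IsTwoSided := by unfold jac; infer_instance
  have : (jac A ^ n).IsTwoSided := inferInstance
  generalize jac A ^ n = I at *
  rw [← aux_comm_iff e hidem horth hone I, aux_perp B hsymm hnondeg hassoc I]
  have hnd : LinearMap.BilinForm.Nondegenerate B :=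
    ⟨hnondeg, fun a h => hnondeg a fun b => by rw [hsymm]; exact h b⟩
  have hrefl : LinearMap.IsRefl B := fun a b h => by rw [hsymm]; exact h
  have h1 := LinearMap.BilinForm.finrank_orthogonal hnd
    (I.restrictScalars F ⊔ commSub F (⊤ : Submodule F A) ⊤)
  have h2 := aux_finrank (F := F) e hidem horth I
  have h3 := aux_W_le (F := F) e hidem horth hone I
  have h4 := Submodule.finrank_le (I.restrictScalars F ⊔ commSub F (⊤ : Submodule F A) ⊤)
  have hIW : I.restrictScalars F ≤ auxW F e I := fun x hx =>
    (mem_auxW e I x).2 fun i => I.mul_mem_right _ (I.mul_mem_left _ hx)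
  constructor
  · intro h
    have h5 := Submodule.eq_of_le_of_finrank_eq h3 (by omega)
    rw [h5]
    exact le_sup_right
  · intro h
    have h5 := le_antisymm h3 (sup_le hIW h)
    rw [← h5] at h1 ⊢
    omega
end

section
/- (Okuyama) Assume that e_i A e_i = F·e_i + e_i J e_i for every i, and that e_i A e_j ⊆ J for all i ≠ j. Then dim_F (Ann_A(J²) ∩ Z(A)) = Σ_{1 ≤ i ≤ l} (dim_F e_i A e_i − dim_F e_i J² e_i). -/
open Module

variable {F : Type*} [Field F]
variable {A : Type*} [Ring A] [Algebra F A]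

lemma jac_sq_eq : jac A ^ 2 = jac A * jac A := by
  rw [show (2 : ℕ) = 1 + 1 from rfl, Submodule.pow_succ, Submodule.pow_one]

lemma okuyama_comm [FiniteDimensional F A]
    (l : ℕ) (e : Fin l → A)
    (hidem : ∀ i, e i * e i = e i)
    (hone : ∑ i, e i = 1)
    (hloc : ∀ i, cornerSub F (e i) (e i) =
      Submodule.span F {e i} ⊔ cornerOf F (e i) (e i) (jac A))
    (hrad : ∀ i j, i ≠ j → cornerSub F (e i) (e j) ≤ (jac A).restrictScalars F)
    (hts : (jac A).IsTwoSided) (b c : A) (i : Fin l) :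
    e i * (b * c - c * b) * e i ∈ jac A ^ 2 := by
  have key : ∀ b c : A, e i * (b * c) * e i
      - (e i * b * e i) * (e i * c * e i) ∈ jac A ^ 2 := by
    intro b c
    have h1 : e i * (b * c) * e i = ∑ j, (e i * b * e j) * (e j * c * e i) := by
      calc e i * (b * c) * e i = e i * b * (∑ j, e j) * (c * e i) := by
            rw [hone]; noncomm_ring
        _ = _ := by
            rw [Finset.mul_sum, Finset.sum_mul]
            refine Finset.sum_congr rfl fun j _ => ?_
            calc e i * b * e j * (c * e i) = e i * b * (e j * e j) * (c * e i) := by rw [hidem]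
              _ = _ := by simp only [mul_assoc]
    rw [h1, ← Finset.add_sum_erase _ _ (Finset.mem_univ i), add_sub_cancel_left]
    refine Ideal.sum_mem _ fun j hj => ?_
    have hji : j ≠ i := Finset.ne_of_mem_erase hj
    rw [jac_sq_eq]
    exact Ideal.mul_mem_mul (hrad i j hji.symm ⟨b, rfl⟩) (hrad j i hji ⟨c, rfl⟩)
  have dec : ∀ b : A, ∃ t : F, ∃ x ∈ jac A, e i * b * e i = t • e i + e i * x * e i := by
    intro b
    have h : e i * b * e i ∈ cornerSub F (e i) (e i) := ⟨b, rfl⟩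
    rw [hloc, Submodule.mem_sup] at h
    obtain ⟨y, hy, z, ⟨x, hx, rfl⟩, h⟩ := h
    obtain ⟨t, rfl⟩ := Submodule.mem_span_singleton.1 hy
    exact ⟨t, x, hx, h.symm⟩
  obtain ⟨s, x, hx, hb⟩ := dec b
  obtain ⟨t, y, hy, hc⟩ := dec c
  have hx' : e i * x * e i ∈ jac A := Ideal.mul_mem_right _ _ (Ideal.mul_mem_left _ _ hx)
  have hy' : e i * y * e i ∈ jac A := Ideal.mul_mem_right _ _ (Ideal.mul_mem_left _ _ hy)
  have l1 : ∀ x, e i * (e i * x * e i) = e i * x * e i := fun x => by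
    rw [← mul_assoc, ← mul_assoc, hidem]
  have l2 : ∀ x, (e i * x * e i) * e i = e i * x * e i := fun x => by
    rw [mul_assoc, hidem]
  have h3 : (e i * b * e i) * (e i * c * e i) - (e i * c * e i) * (e i * b * e i)
      ∈ jac A ^ 2 := by
    have : (e i * b * e i) * (e i * c * e i) - (e i * c * e i) * (e i * b * e i)
      = (e i * x * e i) * (e i * y * e i) - (e i * y * e i) * (e i * x * e i) := by
      rw [hb, hc]
      simp only [add_mul, mul_add, smul_mul_assoc, mul_smul_comm, hidem, l1, l2, smul_add,
        smul_comm t s]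
      abel
    rw [this, jac_sq_eq]
    exact Ideal.sub_mem _ (Ideal.mul_mem_mul hx' hy') (Ideal.mul_mem_mul hy' hx')
  have := Ideal.add_mem _ (Ideal.sub_mem _ (key b c) (key c b)) h3
  convert this using 1
  noncomm_ring

lemma finrank_pi_ker [FiniteDimensional F A] {l : ℕ} {V : Fin l → Type*}
    [∀ i, AddCommGroup (V i)] [∀ i, Module F (V i)] (Q : A →ₗ[F] (Π i, V i))
    (hsurj : Function.Surjective Q) :
    ∑ i, finrank F (V i) + finrank F (LinearMap.ker Q) = finrank F A := by
  have hfin : ∀ i, FiniteDimensional F (V i) := fun i =>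
    Module.Finite.of_surjective ((LinearMap.proj i).comp Q)
      ((Function.surjective_eval i).comp hsurj)
  have hdim := LinearMap.finrank_range_add_finrank_ker Q
  rwa [LinearMap.range_eq_top.2 hsurj, finrank_top, finrank_pi_fintype] at hdim

lemma okuyama_dim [FiniteDimensional F A]
    (l : ℕ) (e : Fin l → A)
    (hidem : ∀ i, e i * e i = e i)
    (horth : ∀ i j, i ≠ j → e i * e j = 0) :
    ∃ W : Submodule F A,
      (∀ a, a ∈ W ↔ ∀ i, e i * a * e i ∈ cornerOf F (e i) (e i) (jac A ^ 2)) ∧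
      (∑ i, (finrank F (cornerSub F (e i) (e i)) -
        finrank F (cornerOf F (e i) (e i) (jac A ^ 2)))) + finrank F W = finrank F A := by
  obtain ⟨Q, hQa⟩ : ∃ Q : A →ₗ[F] (Π i, (cornerSub F (e i) (e i)) ⧸
      ((cornerOf F (e i) (e i) (jac A ^ 2)).comap (cornerSub F (e i) (e i)).subtype)),
      ∀ a i, Q a i = Submodule.Quotient.mk ((cornerMap F (e i) (e i)).rangeRestrict a) :=
    ⟨LinearMap.pi fun i => (Submodule.mkQ _).comp (cornerMap F (e i) (e i)).rangeRestrict,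
      fun _ _ => rfl⟩
  have hQ : ∀ a, a ∈ LinearMap.ker Q ↔
      ∀ i, e i * a * e i ∈ cornerOf F (e i) (e i) (jac A ^ 2) := by
    intro a
    rw [LinearMap.mem_ker, funext_iff]
    refine forall_congr' fun i => ?_
    rw [hQa]
    exact Submodule.Quotient.mk_eq_zero _
  have hsurj : Function.Surjective Q := by
    intro f
    have : ∀ i, ∃ a : A, Submodule.Quotient.mk
        ((cornerMap F (e i) (e i)).rangeRestrict a) = f i := by
      intro i
      obtain ⟨⟨_, a, rfl⟩, h⟩ := Submodule.Quotient.mk_surjective _ (f i)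
      exact ⟨a, h⟩
    choose a ha using this
    refine ⟨∑ j, e j * a j * e j, ?_⟩
    funext i
    rw [← ha i, hQa]
    congr 1
    apply Subtype.ext
    change e i * (∑ j, e j * a j * e j) * e i = e i * a i * e i
    rw [Finset.mul_sum, Finset.sum_mul, Finset.sum_eq_single i]
    · rw [← mul_assoc, ← mul_assoc, hidem, mul_assoc, hidem]
    · intro j _ hj
      rw [← mul_assoc, ← mul_assoc, horth i j hj.symm]
      simp
    · simp
  have hdim := finrank_pi_ker (V := fun i => (cornerSub F (e i) (e i)) ⧸
      ((cornerOf F (e i) (e i) (jac A ^ 2)).comap (cornerSub F (e i) (e i)).subtype)) Q hsurj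
  have hcod : ∀ i, finrank F ((cornerSub F (e i) (e i)) ⧸
      ((cornerOf F (e i) (e i) (jac A ^ 2)).comap (cornerSub F (e i) (e i)).subtype)) =
      finrank F (cornerSub F (e i) (e i)) - finrank F (cornerOf F (e i) (e i) (jac A ^ 2)) := by
    intro i
    have hle : cornerOf F (e i) (e i) (jac A ^ 2) ≤ cornerSub F (e i) (e i) := by
      rintro _ ⟨x, _, rfl⟩
      exact ⟨x, rfl⟩
    rw [Submodule.finrank_quotient, (Submodule.comapSubtypeEquivOfLe hle).finrank_eq]
  rw [Finset.sum_congr rfl fun i _ => hcod i] at hdim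
  exact ⟨LinearMap.ker Q, hQ, hdim⟩

theorem okuyama [FiniteDimensional F A]
    (B : A →ₗ[F] A →ₗ[F] F)
    (hsymm : ∀ a b : A, B a b = B b a)
    (hnondeg : ∀ a : A, (∀ b : A, B a b = 0) → a = 0)
    (hassoc : ∀ a b c : A, B (a * b) c = B a (b * c))
    (l : ℕ) (e : Fin l → A)
    (hidem : ∀ i, e i * e i = e i)
    (horth : ∀ i j, i ≠ j → e i * e j = 0)
    (hone : ∑ i, e i = 1)
    (hloc : ∀ i, cornerSub F (e i) (e i) =
      Submodule.span F {e i} ⊔ cornerOf F (e i) (e i) (jac A))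
    (hrad : ∀ i j, i ≠ j → cornerSub F (e i) (e j) ≤ (jac A).restrictScalars F) :
    finrank F ↥(annL F ((jac A ^ 2 : Ideal A) : Set A) ⊓ centerSub F A) =
      ∑ i, (finrank F (cornerSub F (e i) (e i)) -
        finrank F (cornerOf F (e i) (e i) (jac A ^ 2))) := by
  have hts : (jac A).IsTwoSided := by unfold jac; infer_instance
  have hts2 : (jac A ^ 2).IsTwoSided := inferInstance
  obtain ⟨W, hQ, hdim⟩ := okuyama_dim (F := F) l e hidem horth
  have hco : ∀ i a, e i * a * e i ∈ jac A ^ 2 →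
      e i * a * e i ∈ cornerOf F (e i) (e i) (jac A ^ 2) := by
    intro i a h
    refine ⟨_, h, ?_⟩
    change e i * (e i * a * e i) * e i = _
    rw [← mul_assoc, ← mul_assoc, hidem, mul_assoc, hidem]
  have hco' : ∀ i a, a ∈ cornerOf F (e i) (e i) (jac A ^ 2) → a ∈ jac A ^ 2 := by
    rintro i _ ⟨x, hx, rfl⟩
    exact Ideal.mul_mem_right _ _ (Ideal.mul_mem_left _ _ hx)
  have hnd : LinearMap.BilinForm.Nondegenerate B :=
    ⟨hnondeg, fun a h => hnondeg a fun b => by rw [hsymm]; exact h b⟩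
  have hperp := LinearMap.BilinForm.finrank_orthogonal hnd W
  have heq : annL F ((jac A ^ 2 : Ideal A) : Set A) ⊓ centerSub F A =
      LinearMap.BilinForm.orthogonal B W := by
    ext a
    rw [LinearMap.BilinForm.mem_orthogonal_iff]
    constructor
    · rintro ⟨h1, h2⟩ u hu
      change B u a = 0
      have hz : ∀ x, x * a = a * x := fun x =>
        (Subalgebra.mem_center_iff (R := F)).1 h2 x
      have hu' : u = ∑ i, ∑ j, e i * u * e j := by
        simp_rw [← Finset.mul_sum, ← Finset.sum_mul, hone, one_mul, mul_one]
      rw [hu']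
      simp only [map_sum, LinearMap.sum_apply]
      refine Finset.sum_eq_zero fun i _ => Finset.sum_eq_zero fun j _ => ?_
      by_cases hij : i = j
      · subst hij
        have h3 := h1 _ (hco' i _ ((hQ u).1 hu i))
        rw [← one_mul (e i * u * e i), hassoc, h3, map_zero]
      · rw [hassoc, hz, ← hassoc, hsymm, ← hassoc, ← mul_assoc,
          horth j i (Ne.symm hij)]
        simp
    · intro h
      have h' : ∀ u ∈ W, B u a = 0 := h
      refine ⟨?_, ?_⟩
      · intro x hx
        refine hnondeg _ fun b => ?_
        rw [hsymm, ← hassoc]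
        refine h' _ ((hQ _).2 fun i => ⟨b * x, Ideal.mul_mem_left _ _ hx, rfl⟩)
      · refine (Subalgebra.mem_center_iff (R := F)).2 fun b => ?_
        rw [← sub_eq_zero]
        refine hnondeg _ fun c => ?_
        have h3 := h' (b * c - c * b) ((hQ _).2 fun i => hco i _
          (okuyama_comm l e hidem hone hloc hrad hts b c i))
        rw [map_sub, LinearMap.sub_apply] at h3 ⊢
        rw [hsymm (b * a) c, ← hassoc, hassoc a b c, hsymm a, ← neg_sub, h3, neg_zero]
  rw [heq, hperp]
  exact Nat.sub_eq_of_eq_add hdim.symm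
end

section
/- Let n ≥ 1 be an integer and suppose dim_F (Ann_A(J^n) ∩ Z(A)) = Σ_{1 ≤ i ≤ l} (dim_F e_i A e_i − dim_F e_i J^n e_i). Then for every integer n' with 1 ≤ n' ≤ n one also has dim_F (Ann_A(J^{n'}) ∩ Z(A)) = Σ_{1 ≤ i ≤ l} (dim_F e_i A e_i − dim_F e_i J^{n'} e_i). -/
open Module

variable {F : Type*} [Field F]
variable {A : Type*} [Ring A] [Algebra F A]

section helpers

/-- The projection `a ↦ ∑ i, e i * a * e i`. -/
noncomputable def diagMap (F : Type*) [Field F] {A : Type*} [Ring A] [Algebra F A] {l : ℕ}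
    (e : Fin l → A) : A →ₗ[F] A := ∑ i, cornerMap F (e i) (e i)

theorem cornerMap_app (e f a : A) : cornerMap F e f a = e * a * f := rfl

theorem diagMap_app {l : ℕ} (e : Fin l → A) (a : A) :
    diagMap F e a = ∑ i, e i * a * e i := by
  simp [diagMap, cornerMap_app]

theorem corner_diag {l : ℕ} (e : Fin l → A)
    (hidem : ∀ i, e i * e i = e i)
    (horth : ∀ i j, i ≠ j → e i * e j = 0) (g : Fin l → A) (j : Fin l) :
    e j * (∑ i, e i * g i * e i) * e j = e j * g j * e j := by
  rw [Finset.mul_sum, Finset.sum_mul, Finset.sum_eq_single j]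
  · rw [show e j * (e j * g j * e j) * e j = (e j * e j) * g j * (e j * e j) by noncomm_ring,
      hidem]
  · intro i _ hij
    rw [show e j * (e i * g i * e i) * e j = (e j * e i) * g i * (e i * e j) by noncomm_ring,
      horth i j hij, mul_zero]
  · simp

theorem finrank_diag [FiniteDimensional F A] {l : ℕ} (e : Fin l → A)
    (hidem : ∀ i, e i * e i = e i)
    (horth : ∀ i j, i ≠ j → e i * e j = 0) (S : Ideal A) [S.IsTwoSided] :
    finrank F ↥((S.restrictScalars F).map (diagMap F e)) =
      ∑ i, finrank F (cornerOf F (e i) (e i) S) := by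
  let φ : (∀ i, cornerOf F (e i) (e i) S) →ₗ[F] A :=
    ∑ i, (cornerOf F (e i) (e i) S).subtype ∘ₗ LinearMap.proj i
  have hφ : ∀ f, φ f = ∑ i, (f i : A) := by intro f; simp [φ]
  have hrep : ∀ f : (∀ i, cornerOf F (e i) (e i) S), ∃ g : Fin l → A,
      (∀ i, g i ∈ S) ∧ ∀ i, (f i : A) = e i * g i * e i := by
    intro f
    have h : ∀ i, ∃ x, x ∈ S ∧ (f i : A) = e i * x * e i := by
      intro i
      obtain ⟨x, hx, h⟩ := (f i).2
      exact ⟨x, hx, h.symm⟩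
    choose g hg using h
    exact ⟨g, fun i => (hg i).1, fun i => (hg i).2⟩
  have hinj : Function.Injective φ := by
    rw [← LinearMap.ker_eq_bot, LinearMap.ker_eq_bot']
    intro f hf
    obtain ⟨g, -, hg⟩ := hrep f
    rw [hφ] at hf
    simp only [hg] at hf
    funext j
    apply Subtype.ext
    rw [hg, ← corner_diag e hidem horth g j, hf]
    simp
  have hrange : LinearMap.range φ = (S.restrictScalars F).map (diagMap F e) := by
    apply le_antisymm
    · rintro _ ⟨f, rfl⟩
      obtain ⟨g, hgS, hg⟩ := hrep f
      refine ⟨∑ i, e i * g i * e i, ?_, ?_⟩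
      · exact S.sum_mem fun i _ => S.mul_mem_right _ (S.mul_mem_left _ (hgS i))
      · rw [diagMap_app, hφ]
        exact Finset.sum_congr rfl fun j _ => by rw [corner_diag e hidem horth g j, hg]
    · rintro _ ⟨s, hs, rfl⟩
      refine ⟨fun i => ⟨e i * s * e i, s, hs, rfl⟩, ?_⟩
      rw [hφ, diagMap_app]
  rw [← hrange, LinearMap.finrank_range_of_inj hinj, Module.finrank_pi_fintype]

theorem finrank_ann_diag [FiniteDimensional F A]
    (B : A →ₗ[F] A →ₗ[F] F)
    (hsymm : ∀ a b : A, B a b = B b a)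
    (hnondeg : ∀ a : A, (∀ b : A, B a b = 0) → a = 0)
    (hassoc : ∀ a b c : A, B (a * b) c = B a (b * c))
    {l : ℕ} (e : Fin l → A)
    (hidem : ∀ i, e i * e i = e i)
    (horth : ∀ i j, i ≠ j → e i * e j = 0)
    (S : Ideal A) [S.IsTwoSided] :
    finrank F ↥(annL F (S : Set A) ⊓ LinearMap.range (diagMap F e)) =
      ∑ i, (finrank F (cornerSub F (e i) (e i)) - finrank F (cornerOf F (e i) (e i) S)) := by
  have hpp : ∀ a, diagMap F e (diagMap F e a) = diagMap F e a := by
    intro a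
    simp only [diagMap_app]
    exact Finset.sum_congr rfl fun j _ => corner_diag e hidem horth (fun _ => a) j
  have hadj : ∀ a b, B (diagMap F e a) b = B a (diagMap F e b) := by
    intro a b
    simp only [diagMap_app, map_sum, LinearMap.sum_apply]
    refine Finset.sum_congr rfl fun i _ => ?_
    rw [hassoc, hsymm, ← hassoc, hsymm]
  have hS : ∀ s ∈ S, diagMap F e s ∈ S := by
    intro s hs
    rw [diagMap_app]
    exact S.sum_mem fun i _ => S.mul_mem_right _ (S.mul_mem_left _ hs)
  set P := (S.restrictScalars F).map (diagMap F e) with hP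
  set K := LinearMap.ker (diagMap F e) with hK
  have hnd : LinearMap.BilinForm.Nondegenerate B :=
    ⟨fun a h => hnondeg a h, fun a h => hnondeg a fun b => by rw [hsymm]; exact h b⟩
  have horthEq : annL F (S : Set A) ⊓ LinearMap.range (diagMap F e) =
      LinearMap.BilinForm.orthogonal B (P ⊔ K) := by
    ext a
    constructor
    · rintro ⟨ha, b, rfl⟩ u hu
      obtain ⟨p, ⟨s, hs, rfl⟩, k, hk, rfl⟩ := Submodule.mem_sup.1 hu
      have h1 : B (diagMap F e s) (diagMap F e b) = 0 := by
        have := ha _ (hS s hs)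
        rw [← one_mul (diagMap F e s), hassoc, this, map_zero]
      have h2 : B k (diagMap F e b) = 0 := by
        rw [← hadj, LinearMap.mem_ker.1 hk]; simp
      change B (_ + _) _ = 0
      rw [map_add, LinearMap.add_apply, h1, h2, add_zero]
    · intro ha
      have hfix : diagMap F e a = a := by
        rw [← sub_eq_zero]
        apply hnondeg
        intro b
        rw [map_sub, LinearMap.sub_apply, hadj, ← map_sub, hsymm]
        refine ha _ (Submodule.mem_sup_right ?_)
        rw [hK, LinearMap.mem_ker, map_sub, hpp, sub_self]
      refine ⟨fun u hu => hnondeg _ fun b => ?_, a, hfix⟩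
      rw [hsymm, ← hassoc, ← hfix, ← hadj]
      exact ha _ (Submodule.mem_sup_left ⟨b * u, S.mul_mem_left _ hu, rfl⟩)
  have hdisj : P ⊓ K = ⊥ := by
    rw [eq_bot_iff]
    rintro _ ⟨⟨s, hs, rfl⟩, hk⟩
    rw [hK, SetLike.mem_coe, LinearMap.mem_ker, hpp] at hk
    rw [hk]; exact Submodule.zero_mem _
  have h1 := Submodule.finrank_sup_add_finrank_inf_eq P K
  rw [hdisj, finrank_bot] at h1
  have h2 := LinearMap.finrank_range_add_finrank_ker (diagMap F e)
  have h3 : finrank F (LinearMap.range (diagMap F e)) =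
      ∑ i, finrank F (cornerSub F (e i) (e i)) := by
    have := finrank_diag (F := F) e hidem horth (⊤ : Ideal A)
    have ht : ∀ i, cornerOf F (e i) (e i) (⊤ : Ideal A) = cornerSub F (e i) (e i) := by
      intro i
      rw [cornerOf, cornerSub, LinearMap.range_eq_map, Submodule.restrictScalars_top]
    rw [Finset.sum_congr rfl fun i _ => congrArg (fun W : Submodule F A => finrank F W) (ht i)]
      at this
    rw [← this, LinearMap.range_eq_map, Submodule.restrictScalars_top]
  have h4 : finrank F P = _ := finrank_diag (F := F) e hidem horth S
  change _ + finrank F K = _ at h2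
  rw [horthEq, LinearMap.BilinForm.finrank_orthogonal hnd,
    Finset.sum_tsub_distrib _ fun i _ => ?_, ← h3, ← h4]
  · omega
  · exact Submodule.finrank_mono (LinearMap.map_le_range)

theorem center_le_diag {l : ℕ} (e : Fin l → A)
    (hidem : ∀ i, e i * e i = e i) (hone : ∑ i, e i = 1) :
    centerSub F A ≤ LinearMap.range (diagMap F e) := by
  intro z hz
  refine ⟨z, ?_⟩
  have hz' : ∀ b, b * z = z * b := (Subalgebra.mem_center_iff (R := F)).1 hz
  rw [diagMap_app]
  simp only [hz', mul_assoc, hidem]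
  rw [← Finset.mul_sum, hone, mul_one]

end helpers

theorem eq_of_eq_ge [FiniteDimensional F A]
    (B : A →ₗ[F] A →ₗ[F] F)
    (hsymm : ∀ a b : A, B a b = B b a)
    (hnondeg : ∀ a : A, (∀ b : A, B a b = 0) → a = 0)
    (hassoc : ∀ a b c : A, B (a * b) c = B a (b * c))
    (l : ℕ) (e : Fin l → A)
    (hidem : ∀ i, e i * e i = e i)
    (horth : ∀ i j, i ≠ j → e i * e j = 0)
    (hone : ∑ i, e i = 1)
    (n : ℕ) (hn : 1 ≤ n)
    (heq : finrank F ↥(annL F ((jac A ^ n : Ideal A) : Set A) ⊓ centerSub F A) =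
      ∑ i, (finrank F (cornerSub F (e i) (e i)) -
        finrank F (cornerOf F (e i) (e i) (jac A ^ n)))) :
    ∀ n' : ℕ, 1 ≤ n' → n' ≤ n →
      finrank F ↥(annL F ((jac A ^ n' : Ideal A) : Set A) ⊓ centerSub F A) =
        ∑ i, (finrank F (cornerSub F (e i) (e i)) -
          finrank F (cornerOf F (e i) (e i) (jac A ^ n'))) := by
  intro n' _ hn'
  have htw : ∀ m, (jac A ^ m).IsTwoSided := by
    intro m
    have : (jac A).IsTwoSided := by unfold jac; infer_instance
    infer_instance
  have key := fun m => haveI := htw m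
    finrank_ann_diag B hsymm hnondeg hassoc e hidem horth (jac A ^ m)
  have hle := center_le_diag (F := F) e hidem hone
  have hEq : annL F ((jac A ^ n : Ideal A) : Set A) ⊓ centerSub F A =
      annL F ((jac A ^ n : Ideal A) : Set A) ⊓ LinearMap.range (diagMap F e) :=
    Submodule.eq_of_le_of_finrank_eq (inf_le_inf_left _ hle) (heq.trans (key n).symm)
  rw [← key n']
  refine congrArg (fun W : Submodule F A => finrank F W)
    (le_antisymm (inf_le_inf_left _ hle) ?_)
  rintro a ⟨ha, hd⟩
  have hmem : a ∈ annL F ((jac A ^ n : Ideal A) : Set A) ⊓ LinearMap.range (diagMap F e) :=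
    ⟨fun u hu => ha u (Ideal.pow_le_pow_right hn' hu), hd⟩
  rw [← hEq] at hmem
  exact ⟨ha, hmem.2⟩
end

section
/- Assume that e_i A e_i = F·e_i + e_i J e_i for every i, that e_i A e_j ⊆ J for all i ≠ j, and let λ be the least positive integer with J^λ = 0 (which exists since A is finite-dimensional); assume λ ≥ 2. Then there exists an integer m with 2 ≤ m ≤ λ such that dim_F (Ann_A(J^n) ∩ Z(A)) = Σ_{1 ≤ i ≤ l} (dim_F e_i A e_i − dim_F e_i J^n e_i) for all integers n with 1 ≤ n ≤ m, and dim_F (Ann_A(J^{n'}) ∩ Z(A)) < Σ_{1 ≤ i ≤ l} (dim_F e_i A e_i − dim_F e_i J^{n'} e_i) for all integers n' with m < n' ≤ λ. -/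
open Module

variable {F : Type*} [Field F]
variable {A : Type*} [Ring A] [Algebra F A]

/-- The subspace of elements whose diagonal Peirce components all lie in `I`. -/
def diagIn (F : Type*) [Field F] {A : Type*} [Ring A] [Algebra F A] {l : ℕ} (e : Fin l → A)
    (I : Ideal A) : Submodule F A :=
  ⨅ i, Submodule.comap (cornerMap F (e i) (e i)) (I.restrictScalars F)

theorem mem_diagIn {l : ℕ} (e : Fin l → A) (I : Ideal A) (a : A) :
    a ∈ diagIn F e I ↔ ∀ i, e i * a * e i ∈ I := by
  simp [diagIn, Submodule.mem_iInf, cornerMap_app]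

theorem finrank_pi_surj {V : Type*} [AddCommGroup V] [Module F V] [FiniteDimensional F V]
    {l : ℕ} {W : Fin l → Type*} [∀ i, AddCommGroup (W i)] [∀ i, Module F (W i)]
    [∀ i, FiniteDimensional F (W i)]
    (g : ∀ i, V →ₗ[F] W i) (hs : ∀ w : ∀ i, W i, ∃ v, ∀ i, g i v = w i) :
    ∑ i, finrank F (W i) = finrank F V - finrank F ↥(⨅ i, LinearMap.ker (g i)) := by
  have hs' : LinearMap.range (LinearMap.pi g) = ⊤ := by
    rw [LinearMap.range_eq_top]
    intro w
    obtain ⟨v, hv⟩ := hs w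
    exact ⟨v, funext hv⟩
  have h := (LinearMap.pi g).finrank_range_add_finrank_ker
  rw [hs', finrank_top, LinearMap.ker_pi, Module.finrank_pi_fintype] at h
  omega

theorem finrank_corner_gen {V : Type*} [AddCommGroup V] [Module F V] [FiniteDimensional F V]
    {l : ℕ} (f : Fin l → V →ₗ[F] V) (N : Fin l → Submodule F V)
    (hN : ∀ i, N i ≤ LinearMap.range (f i))
    (hs : ∀ a : Fin l → V, ∃ x, ∀ i, f i x = f i (a i)) :
    ∑ i, (finrank F (LinearMap.range (f i)) - finrank F (N i)) =
      finrank F V - finrank F ↥(⨅ i, Submodule.comap (f i) (N i)) := by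
  have h := finrank_pi_surj (F := F)
    (W := fun i => LinearMap.range (f i) ⧸ (N i).comap (LinearMap.range (f i)).subtype)
    (fun i => (Submodule.mkQ _).comp (f i).rangeRestrict) (by
      intro w
      have : ∀ i, ∃ a : V, (Submodule.mkQ _) ((f i).rangeRestrict a) = w i := by
        intro i
        obtain ⟨y, hy⟩ := Submodule.mkQ_surjective _ (w i)
        obtain ⟨a, ha⟩ := LinearMap.surjective_rangeRestrict (f i) y
        exact ⟨a, by rw [ha]; exact hy⟩
      choose a ha using this
      obtain ⟨x, hx⟩ := hs a
      refine ⟨x, fun i => ?_⟩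
      rw [← ha i, LinearMap.comp_apply]
      congr 1
      exact Subtype.ext (hx i))
  have hk : ∀ i, LinearMap.ker ((Submodule.mkQ ((N i).comap (LinearMap.range (f i)).subtype)).comp
      (f i).rangeRestrict) = Submodule.comap (f i) (N i) := by
    intro i
    rw [LinearMap.ker_comp, Submodule.ker_mkQ]
    rfl
  rw [iInf_congr hk] at h
  rw [← h]
  refine Finset.sum_congr rfl fun i _ => ?_
  rw [Submodule.finrank_quotient, (Submodule.comapSubtypeEquivOfLe (hN i)).finrank_eq]

theorem rhs_eq [FiniteDimensional F A] {l : ℕ} (e : Fin l → A)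
    (hidem : ∀ i, e i * e i = e i)
    (horth : ∀ i j, i ≠ j → e i * e j = 0) (I : Ideal A) [I.IsTwoSided] :
    ∑ i, (finrank F (cornerSub F (e i) (e i)) - finrank F (cornerOf F (e i) (e i) I)) =
      finrank F A - finrank F (diagIn F e I) := by
  have hee : ∀ i a, e i * (e i * a * e i) * e i = e i * a * e i := by
    intro i a
    calc e i * (e i * a * e i) * e i = (e i * e i) * a * (e i * e i) := by
          simp only [mul_assoc]
      _ = _ := by rw [hidem]
  have hD : diagIn F e I =
      ⨅ i, Submodule.comap (cornerMap F (e i) (e i)) (cornerOf F (e i) (e i) I) := by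
    refine iInf_congr fun i => le_antisymm ?_ ?_
    · intro a ha
      exact ⟨e i * a * e i, ha, hee i a⟩
    · rintro a ⟨x, hx, hxe⟩
      have hm : e i * x * e i ∈ I := I.mul_mem_right _ (I.mul_mem_left _ hx)
      rw [cornerMap_app] at hxe
      rw [hxe] at hm
      exact hm
  rw [hD]
  refine finrank_corner_gen (fun i => cornerMap F (e i) (e i))
    (fun i => cornerOf F (e i) (e i) I) (fun i => LinearMap.map_le_range) ?_
  intro a
  refine ⟨∑ j, e j * a j * e j, fun i => ?_⟩
  rw [cornerMap_app, cornerMap_app, Finset.mul_sum, Finset.sum_mul, Finset.sum_eq_single i]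
  · exact hee i (a i)
  · intro j _ hj
    have h0 : e i * (e j * a j * e j) * e i = (e i * e j) * (a j * e j * e i) := by
      simp only [mul_assoc]
    rw [h0, horth i j (Ne.symm hj), zero_mul]
  · simp

theorem lhs_eq [FiniteDimensional F A]
    (B : A →ₗ[F] A →ₗ[F] F)
    (hsymm : ∀ a b : A, B a b = B b a)
    (hnondeg : ∀ a : A, (∀ b : A, B a b = 0) → a = 0)
    (hassoc : ∀ a b c : A, B (a * b) c = B a (b * c)) (I : Ideal A) :
    finrank F ↥(annL F (I : Set A) ⊓ centerSub F A) =
      finrank F A - finrank F ↥(I.restrictScalars F ⊔ commSub F (⊤ : Submodule F A) ⊤) := by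
  have hnd : LinearMap.BilinForm.Nondegenerate B :=
    ⟨fun x hx => hnondeg x hx, fun x hx => hnondeg x fun b => by rw [hsymm]; exact hx b⟩
  rw [← LinearMap.BilinForm.finrank_orthogonal hnd]
  have key : annL F (I : Set A) ⊓ centerSub F A = LinearMap.BilinForm.orthogonal B
      (I.restrictScalars F ⊔ commSub F (⊤ : Submodule F A) ⊤) := by
    ext a
    rw [LinearMap.BilinForm.mem_orthogonal_iff]
    constructor
    · rintro ⟨h1, h2⟩ n hn
      have h2' : ∀ b, b * a = a * b := (Subalgebra.mem_center_iff (R := F)).1 h2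
      have hle : I.restrictScalars F ⊔ commSub F (⊤ : Submodule F A) ⊤ ≤
          LinearMap.ker (B.flip a) := by
        refine sup_le ?_ (Submodule.span_le.2 ?_)
        · intro x hx
          change B x a = 0
          have := hassoc 1 x a
          rw [one_mul, h1 x hx] at this
          simpa using this
        · rintro x ⟨u, _, v, _, rfl⟩
          change B (u * v - v * u) a = 0
          rw [map_sub, LinearMap.sub_apply, hassoc u v a, h2' v, hsymm (v * u),
            ← hassoc a v u, hsymm u, sub_self]
      exact hle hn
    · intro h
      refine ⟨fun x hx => ?_, (Subalgebra.mem_center_iff (R := F)).2 fun b => ?_⟩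
      · apply hnondeg
        intro b
        rw [hsymm, ← hassoc]
        exact h _ (Submodule.mem_sup_left (I.mul_mem_left b hx))
      · rw [← sub_eq_zero]
        apply hnondeg
        intro c
        have hc := h (c * b - b * c)
          (Submodule.mem_sup_right (Submodule.subset_span ⟨c, trivial, b, trivial, rfl⟩))
        rw [map_sub, LinearMap.sub_apply, hassoc c b a, hsymm (b * c), ← hassoc a b c] at hc
        rw [hsymm, map_sub, hsymm c (a * b)]
        exact hc
  rw [key]

theorem peirce_sum_eq {l : ℕ} (e : Fin l → A) (hone : ∑ i, e i = 1) (a : A) :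
    a = ∑ i, ∑ j, e i * a * e j := by
  simp_rw [← Finset.mul_sum, hone, mul_one, ← Finset.sum_mul, hone, one_mul]

theorem diagIn_le {l : ℕ} (e : Fin l → A)
    (hidem : ∀ i, e i * e i = e i)
    (horth : ∀ i j, i ≠ j → e i * e j = 0)
    (hone : ∑ i, e i = 1) (I : Ideal A) :
    diagIn F e I ≤ I.restrictScalars F ⊔ commSub F (⊤ : Submodule F A) ⊤ := by
  intro a ha
  rw [mem_diagIn] at ha
  rw [peirce_sum_eq e hone a]
  refine Submodule.sum_mem _ fun i _ => Submodule.sum_mem _ fun j _ => ?_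
  by_cases hij : i = j
  · subst hij
    exact Submodule.mem_sup_left (ha i)
  · refine Submodule.mem_sup_right (Submodule.subset_span
      ⟨e i, trivial, e i * a * e j, trivial, ?_⟩)
    have h1 : e i * (e i * a * e j) = e i * e i * a * e j := by noncomm_ring
    rw [h1, hidem, mul_assoc _ (e j), horth j i (Ne.symm hij), mul_zero, sub_zero]

theorem comm_le_two {l : ℕ} (e : Fin l → A)
    (hidem : ∀ i, e i * e i = e i)
    (hone : ∑ i, e i = 1) (J : Ideal A) [J.IsTwoSided]
    (hloc : ∀ i, cornerSub F (e i) (e i) =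
      Submodule.span F {e i} ⊔ cornerOf F (e i) (e i) J)
    (hrad : ∀ i j, i ≠ j → cornerSub F (e i) (e j) ≤ J.restrictScalars F) :
    commSub F (⊤ : Submodule F A) ⊤ ≤ diagIn F e (J ^ 2) := by
  have hsq : J ^ 2 = J * J := by
    rw [Submodule.pow_succ, Submodule.pow_one]
  have hprod : ∀ k a b, e k * (a * b) * e k - (e k * a * e k) * (e k * b * e k) ∈ J ^ 2 := by
    intro k a b
    have h : e k * (a * b) * e k = ∑ j, (e k * a * e j) * (e j * b * e k) := by
      have : ∀ j, (e k * a * e j) * (e j * b * e k) = e k * a * e j * (b * e k) := by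
        intro j
        calc _ = e k * a * (e j * e j) * (b * e k) := by noncomm_ring
          _ = _ := by rw [hidem]
      simp_rw [this, ← Finset.sum_mul, ← Finset.mul_sum, hone]
      noncomm_ring
    rw [h, ← Finset.add_sum_erase _ _ (Finset.mem_univ k), add_sub_cancel_left]
    refine Submodule.sum_mem _ fun j hj => ?_
    have hj' := Finset.ne_of_mem_erase hj
    rw [hsq]
    exact Ideal.mul_mem_mul (hrad k j (Ne.symm hj') ⟨a, rfl⟩) (hrad j k hj' ⟨b, rfl⟩)
  have hdec : ∀ k a, ∃ c : F, ∃ x ∈ J, e k * x * e k = x ∧ e k * a * e k = c • e k + x := by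
    intro k a
    have : e k * a * e k ∈ cornerSub F (e k) (e k) := ⟨a, rfl⟩
    rw [hloc, Submodule.mem_sup] at this
    obtain ⟨y, hy, z, ⟨w, hw, rfl⟩, h⟩ := this
    obtain ⟨c, rfl⟩ := Submodule.mem_span_singleton.1 hy
    refine ⟨c, _, J.mul_mem_right (e k) (J.mul_mem_left (e k) hw), ?_, h.symm⟩
    calc e k * (e k * w * e k) * e k = (e k * e k) * w * (e k * e k) := by noncomm_ring
      _ = _ := by rw [hidem]
  refine Submodule.span_le.2 ?_
  rintro _ ⟨a, _, b, _, rfl⟩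
  refine (mem_diagIn _ _ _).2 fun k => ?_
  have h3 : (e k * a * e k) * (e k * b * e k) - (e k * b * e k) * (e k * a * e k) ∈ J ^ 2 := by
    obtain ⟨c, x, hx, hxe, h1⟩ := hdec k a
    obtain ⟨d, y, hy, hye, h2⟩ := hdec k b
    have l1 : ∀ z, e k * z * e k = z → e k * z = z := fun z hz => by
      rw [← hz, ← mul_assoc, ← mul_assoc, hidem]
    have r1 : ∀ z, e k * z * e k = z → z * e k = z := fun z hz => by
      rw [← hz, mul_assoc _ (e k), hidem]
    have : (e k * a * e k) * (e k * b * e k) - (e k * b * e k) * (e k * a * e k)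
        = x * y - y * x := by
      rw [h1, h2]
      simp only [add_mul, mul_add, smul_mul_assoc, mul_smul_comm, l1 x hxe, l1 y hye,
        r1 x hxe, r1 y hye, hidem, smul_add, smul_comm d c (e k)]
      abel
    rw [this, hsq]
    exact Submodule.sub_mem _ (Ideal.mul_mem_mul hx hy) (Ideal.mul_mem_mul hy hx)
  have := Submodule.add_mem _ (Submodule.sub_mem _ (hprod k a b) (hprod k b a)) h3
  convert this using 1
  noncomm_ring

theorem exists_threshold [FiniteDimensional F A]
    (B : A →ₗ[F] A →ₗ[F] F)
    (hsymm : ∀ a b : A, B a b = B b a)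
    (hnondeg : ∀ a : A, (∀ b : A, B a b = 0) → a = 0)
    (hassoc : ∀ a b c : A, B (a * b) c = B a (b * c))
    (l : ℕ) (e : Fin l → A)
    (hidem : ∀ i, e i * e i = e i)
    (horth : ∀ i j, i ≠ j → e i * e j = 0)
    (hone : ∑ i, e i = 1)
    (hloc : ∀ i, cornerSub F (e i) (e i) =
      Submodule.span F {e i} ⊔ cornerOf F (e i) (e i) (jac A))
    (hrad : ∀ i j, i ≠ j → cornerSub F (e i) (e j) ≤ (jac A).restrictScalars F)
    (lam : ℕ) (hlampos : 0 < lam) (hzero : jac A ^ lam = ⊥)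
    (hleast : ∀ k : ℕ, 0 < k → jac A ^ k = ⊥ → lam ≤ k)
    (hlam2 : 2 ≤ lam) :
    ∃ m : ℕ, 2 ≤ m ∧ m ≤ lam ∧
      (∀ n : ℕ, 1 ≤ n → n ≤ m →
        finrank F ↥(annL F ((jac A ^ n : Ideal A) : Set A) ⊓ centerSub F A) =
          ∑ i, (finrank F (cornerSub F (e i) (e i)) -
            finrank F (cornerOf F (e i) (e i) (jac A ^ n)))) ∧
      (∀ n' : ℕ, m < n' → n' ≤ lam →
        finrank F ↥(annL F ((jac A ^ n' : Ideal A) : Set A) ⊓ centerSub F A) <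
          ∑ i, (finrank F (cornerSub F (e i) (e i)) -
            finrank F (cornerOf F (e i) (e i) (jac A ^ n')))) := by
  classical
  have : (jac A).IsTwoSided := by unfold jac; infer_instance
  have hJV : ∀ n, (jac A ^ n).restrictScalars F ≤ diagIn F e (jac A ^ n) := fun n x hx =>
    (mem_diagIn _ _ _).2 fun i => (jac A ^ n).mul_mem_right _ ((jac A ^ n).mul_mem_left _ hx)
  have hVle := fun n => diagIn_le (F := F) e hidem horth hone (jac A ^ n)
  have hEq : ∀ n, commSub F (⊤ : Submodule F A) ⊤ ≤ diagIn F e (jac A ^ n) →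
      finrank F ↥(annL F ((jac A ^ n : Ideal A) : Set A) ⊓ centerSub F A) =
          ∑ i, (finrank F (cornerSub F (e i) (e i)) -
            finrank F (cornerOf F (e i) (e i) (jac A ^ n))) := by
    intro n hn
    rw [rhs_eq e hidem horth, lhs_eq B hsymm hnondeg hassoc,
      le_antisymm (sup_le (hJV n) hn) (hVle n)]
  have hLt : ∀ n, ¬ commSub F (⊤ : Submodule F A) ⊤ ≤ diagIn F e (jac A ^ n) →
      finrank F ↥(annL F ((jac A ^ n : Ideal A) : Set A) ⊓ centerSub F A) <
          ∑ i, (finrank F (cornerSub F (e i) (e i)) -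
            finrank F (cornerOf F (e i) (e i) (jac A ^ n))) := by
    intro n hn
    rw [rhs_eq e hidem horth, lhs_eq B hsymm hnondeg hassoc]
    have h1 : diagIn F e (jac A ^ n) < (jac A ^ n).restrictScalars F ⊔ commSub F (⊤ : Submodule F A) ⊤ :=
      lt_of_le_of_ne (hVle n) fun h => hn (h ▸ le_sup_right)
    have h2 := Submodule.finrank_lt_finrank_of_lt h1
    have h3 := Submodule.finrank_le ((jac A ^ n).restrictScalars F ⊔ commSub F (⊤ : Submodule F A) ⊤)
    omega
  have h2 : commSub F (⊤ : Submodule F A) ⊤ ≤ diagIn F e (jac A ^ 2) := comm_le_two e hidem hone (jac A) hloc hrad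
  have hmono : ∀ n m, n ≤ m → commSub F (⊤ : Submodule F A) ⊤ ≤ diagIn F e (jac A ^ m) → commSub F (⊤ : Submodule F A) ⊤ ≤ diagIn F e (jac A ^ n) := by
    intro n m hnm h x hx
    exact (mem_diagIn _ _ _).2 fun i =>
      Ideal.pow_le_pow_right hnm ((mem_diagIn _ _ _).1 (h hx) i)
  let P : ℕ → Prop := fun n => commSub F (⊤ : Submodule F A) ⊤ ≤ diagIn F e (jac A ^ n)
  refine ⟨Nat.findGreatest P lam, Nat.le_findGreatest hlam2 h2, Nat.findGreatest_le lam, ?_, ?_⟩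
  · intro n _ hn
    exact hEq n (hmono _ _ hn (Nat.findGreatest_spec (P := P) hlam2 h2))
  · intro n hn hn'
    exact hLt n (Nat.findGreatest_is_greatest (P := P) hn hn')
end
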